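/- For every positive integer r and every integer n ≥ 2, in ℤ[q] one has ∑_{σ ∈ G_{r,n}} q^{exc^Abs(σ)} (−1)^{cyc(σ)} = (q^r − 1) · ∑_{σ ∈ G_{r,n−1}} q^{exc^Abs(σ)} (−1)^{cyc(σ)}. -/

import Mathlib

open Finset Polynomial

/-- Number of excedances of a permutation: #{i : τ(i) > i}. -/
def exc {n : ℕ} (τ : Equiv.Perm (Fin n)) : ℕ :=
  (Finset.univ.filter fun i => i < τ i).card

/-- Number of cycles of a permutation, counting fixed points as cycles. -/
def cyc {n : ℕ} (τ : Equiv.Perm (Fin n)) : ℕ :=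
  Multiset.card τ.cycleType + (Finset.univ.filter fun i => τ i = i).card

/-- Color sum of a colored permutation. -/
def csum {r n : ℕ} (z : Fin n → Fin r) : ℕ := ∑ i, (z i : ℕ)

/-- #{i : z_i = 0 and τ(i) > i}. -/
def excA {r n : ℕ} (z : Fin n → Fin r) (τ : Equiv.Perm (Fin n)) : ℕ :=
  (Finset.univ.filter fun i => (z i : ℕ) = 0 ∧ i < τ i).card

/-- Excedance number with respect to the absolute order. -/
def excAbs {r n : ℕ} (z : Fin n → Fin r) (τ : Equiv.Perm (Fin n)) : ℕ :=
  exc τ + csum z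

/-- Excedance number with respect to the color order. -/
def excClr {r n : ℕ} (z : Fin n → Fin r) (τ : Equiv.Perm (Fin n)) : ℕ :=
  r * excA z τ + csum z

theorem neg_one_pow_cyc {n : ℕ} (τ : Equiv.Perm (Fin n)) :
    (-1 : Polynomial ℤ) ^ cyc τ = (-1) ^ n * ((Equiv.Perm.sign τ : ℤ) : Polynomial ℤ) := by
  have hfix : τ.support.card + (Finset.univ.filter fun i => τ i = i).card = n := by
    have h := Finset.card_filter_add_card_filter_not (s := (Finset.univ : Finset (Fin n)))
      (fun i => τ i = i)
    simp only [Finset.card_univ, Fintype.card_fin] at h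
    rw [Equiv.Perm.support, add_comm]
    exact h
  rw [Equiv.Perm.sign_of_cycleType, Equiv.Perm.sum_cycleType]
  push_cast
  rw [← pow_add, cyc]
  apply neg_one_pow_congr
  have hpar := congrArg Even hfix
  rw [Nat.even_add] at hpar
  rw [Nat.even_add, Nat.even_add, Nat.even_add, ← hpar]
  tauto

/-- The matrix with entries `X` strictly below the diagonal and `1` elsewhere. -/
noncomputable def excMatrix (n : ℕ) : Matrix (Fin n) (Fin n) (Polynomial ℤ) :=
  Matrix.of fun a i => if i < a then X else 1

theorem det_excMatrix_succ (n : ℕ) : (excMatrix (n + 1)).det = (1 - X) ^ n := by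
  let B : Matrix (Fin (n + 1)) (Fin (n + 1)) (Polynomial ℤ) :=
    Matrix.of fun a i => if i = 0 then excMatrix (n + 1) a 0 else if a = i then 1 - X else 0
  have hAB : (excMatrix (n + 1)).det = B.det := by
    refine Matrix.det_eq_of_forall_col_eq_smul_add_pred (fun _ => 1) (fun a => ?_) fun a j => ?_
    · simp [B]
    · simp only [B, excMatrix, Matrix.of_apply, Fin.succ_ne_zero, if_false, one_mul]
      simp only [Fin.lt_def, Fin.ext_iff, Fin.val_succ, Fin.val_castSucc]
      split_ifs <;> first | omega | ring
  have hB : B.IsLowerTriangular := by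
    intro a i hai
    have h : a < i := hai
    have hi : i ≠ 0 := (Fin.zero_le a).trans_lt h |>.ne'
    simp [B, hi, h.ne]
  rw [hAB, Matrix.det_of_isLowerTriangular B hB, Fin.prod_univ_succ]
  simp [B, excMatrix, Fin.succ_ne_zero]

theorem sum_X_pow_exc_mul_sign (n : ℕ) :
    ∑ τ : Equiv.Perm (Fin n), (X : Polynomial ℤ) ^ exc τ * ((Equiv.Perm.sign τ : ℤ) : Polynomial ℤ)
      = (excMatrix n).det := by
  rw [Matrix.det_apply']
  refine Finset.sum_congr rfl fun τ _ => ?_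
  simp [excMatrix, Finset.prod_ite, exc, mul_comm]

theorem sum_X_pow_exc_mul_neg_one_pow_cyc_succ (n : ℕ) :
    ∑ τ : Equiv.Perm (Fin (n + 1)), (X : Polynomial ℤ) ^ exc τ * (-1) ^ cyc τ =
      -(X - 1) ^ n := by
  simp_rw [neg_one_pow_cyc, mul_left_comm _ ((-1 : Polynomial ℤ) ^ (n + 1))]
  rw [← Finset.mul_sum, sum_X_pow_exc_mul_sign, det_excMatrix_succ, pow_succ', mul_assoc,
    ← mul_pow]
  ring

theorem sum_X_pow_csum (r n : ℕ) :
    ∑ z : Fin n → Fin r, (X : Polynomial ℤ) ^ csum z = (∑ i ∈ Finset.range r, X ^ i) ^ n := by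
  simp_rw [csum, ← Finset.prod_pow_eq_pow_sum]
  rw [← Fin.sum_univ_eq_sum_range (fun i => (X : Polynomial ℤ) ^ i) r, Fintype.sum_pow]

theorem sum_X_pow_excAbs_mul_neg_one_pow_cyc (r n : ℕ) :
    ∑ σ : (Fin n → Fin r) × Equiv.Perm (Fin n),
      (X : Polynomial ℤ) ^ excAbs σ.1 σ.2 * (-1) ^ cyc σ.2 =
    (∑ i ∈ Finset.range r, X ^ i) ^ n *
      ∑ τ : Equiv.Perm (Fin n), (X : Polynomial ℤ) ^ exc τ * (-1) ^ cyc τ := by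
  rw [← sum_X_pow_csum, Finset.sum_mul_sum, Fintype.sum_prod_type]
  refine Finset.sum_congr rfl fun z _ => Finset.sum_congr rfl fun τ _ => ?_
  rw [excAbs]
  ring

theorem stmt2 (r n : ℕ) (hr : 0 < r) (hn : 2 ≤ n) :
    ∑ σ : (Fin n → Fin r) × Equiv.Perm (Fin n),
      (X : Polynomial ℤ) ^ excAbs σ.1 σ.2 * (-1) ^ cyc σ.2 =
    ((X : Polynomial ℤ) ^ r - 1) *
      ∑ σ : (Fin (n - 1) → Fin r) × Equiv.Perm (Fin (n - 1)),
        (X : Polynomial ℤ) ^ excAbs σ.1 σ.2 * (-1) ^ cyc σ.2 := by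
  obtain ⟨m, rfl⟩ := Nat.exists_eq_add_of_le' hn
  rw [show m + 2 - 1 = m + 1 from rfl, sum_X_pow_excAbs_mul_neg_one_pow_cyc,
    sum_X_pow_excAbs_mul_neg_one_pow_cyc, sum_X_pow_exc_mul_neg_one_pow_cyc_succ,
    sum_X_pow_exc_mul_neg_one_pow_cyc_succ, ← geom_sum_mul]
  ring
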